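/- For any formula A, the sequent □(□(A→□A)→A) ⇒ □A is provable in the non-well-founded sequent calculus Go_∞. -/

import Mathlib

inductive Formula : Type
  | atom : ℕ → Formula
  | bot  : Formula
  | imp  : Formula → Formula → Formula
  | box  : Formula → Formula
deriving DecidableEq

def boxtimes (Γ : Multiset Formula) : Multiset Formula := Γ + Γ.map Formula.box

inductive GoSeq : Bool → Multiset Formula → Multiset Formula → Prop
  | ax (c) (Γ Δ : Multiset Formula) (A : Formula) : GoSeq c (A ::ₘ Γ) (A ::ₘ Δ)
  | axBot (c) (Γ Δ : Multiset Formula) : GoSeq c (Formula.bot ::ₘ Γ) Δ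
  | impL (c) (Γ Δ : Multiset Formula) (A B : Formula) :
      GoSeq c (B ::ₘ Γ) Δ → GoSeq c Γ (A ::ₘ Δ) → GoSeq c ((A.imp B) ::ₘ Γ) Δ
  | impR (c) (Γ Δ : Multiset Formula) (A B : Formula) :
      GoSeq c (A ::ₘ Γ) (B ::ₘ Δ) → GoSeq c Γ ((A.imp B) ::ₘ Δ)
  | boxGo (c) (Γ Δ Θ : Multiset Formula) (A : Formula) :
      GoSeq c ((Formula.box (A.imp (Formula.box A))) ::ₘ boxtimes Θ) {A} →
      GoSeq c (Γ + Θ.map Formula.box) ((Formula.box A) ::ₘ Δ)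
  | cut (Γ Δ : Multiset Formula) (A : Formula) :
      GoSeq true Γ (A ::ₘ Δ) → GoSeq true (A ::ₘ Γ) Δ → GoSeq true Γ Δ

inductive Frag : Bool → ℕ → Multiset Formula → Multiset Formula → Type
  | hole (c) (Γ Δ : Multiset Formula) : Frag c 0 Γ Δ
  | axP (c) (n) (Γ Δ : Multiset Formula) (p : ℕ) :
      Frag c (n+1) (Formula.atom p ::ₘ Γ) (Formula.atom p ::ₘ Δ)
  | axBot (c) (n) (Γ Δ : Multiset Formula) : Frag c (n+1) (Formula.bot ::ₘ Γ) Δ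
  | impL (c) (n) (Γ Δ : Multiset Formula) (A B : Formula) :
      Frag c (n+1) (B ::ₘ Γ) Δ → Frag c (n+1) Γ (A ::ₘ Δ) →
      Frag c (n+1) ((A.imp B) ::ₘ Γ) Δ
  | impR (c) (n) (Γ Δ : Multiset Formula) (A B : Formula) :
      Frag c (n+1) (A ::ₘ Γ) (B ::ₘ Δ) → Frag c (n+1) Γ ((A.imp B) ::ₘ Δ)
  | box (c) (n) (Γ Δ Θ : Multiset Formula) (l : List Formula) (h : l ≠ []) :
      Frag c (n+1) (boxtimes Θ) (boxtimes (↑l)) →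
      ((i : Fin l.length) → Frag c n (boxtimes Θ) {l.get i}) →
      Frag c (n+1) (Γ + Θ.map Formula.box) ((↑(l.map Formula.box) : Multiset Formula) + Δ)
  | cut (n) (Γ Δ : Multiset Formula) (A : Formula) :
      Frag true (n+1) Γ (A ::ₘ Δ) → Frag true (n+1) (A ::ₘ Γ) Δ → Frag true (n+1) Γ Δ

def Frag.trunc : ∀ {c : Bool} {n : ℕ} {Γ Δ : Multiset Formula}, Frag c (n+1) Γ Δ → Frag c n Γ Δ
  | c, 0, Γ, Δ, _ => .hole c Γ Δ
  | c, n+1, _, _, .axP _ _ Γ Δ p => .axP c n Γ Δ p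
  | c, n+1, _, _, .axBot _ _ Γ Δ => .axBot c n Γ Δ
  | c, n+1, _, _, .impL _ _ Γ Δ A B a b => .impL c n Γ Δ A B a.trunc b.trunc
  | c, n+1, _, _, .impR _ _ Γ Δ A B a => .impR c n Γ Δ A B a.trunc
  | c, n+1, _, _, .box _ _ Γ Δ Θ l h a bs => .box c n Γ Δ Θ l h a.trunc (fun i => (bs i).trunc)
  | _, n+1, _, _, .cut _ Γ Δ A a b => .cut n Γ Δ A a.trunc b.trunc

def Frag.height : ∀ {c : Bool} {n : ℕ} {Γ Δ : Multiset Formula}, Frag c n Γ Δ → ℕ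
  | _, _, _, _, .hole _ _ _ => 0
  | _, _, _, _, .axP _ _ _ _ _ => 0
  | _, _, _, _, .axBot _ _ _ _ => 0
  | _, _, _, _, .impL _ _ _ _ _ _ a b => max a.height b.height + 1
  | _, _, _, _, .impR _ _ _ _ _ _ a => a.height + 1
  | _, _, _, _, .box _ _ _ _ _ _ _ a bs =>
      max a.height (Finset.univ.sup fun i => (bs i).height) + 1
  | _, _, _, _, .cut _ _ _ _ a b => max a.height b.height + 1

def Frag.cutFree : ∀ {c : Bool} {n : ℕ} {Γ Δ : Multiset Formula}, Frag c n Γ Δ → Prop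
  | _, _, _, _, .hole _ _ _ => True
  | _, _, _, _, .axP _ _ _ _ _ => True
  | _, _, _, _, .axBot _ _ _ _ => True
  | _, _, _, _, .impL _ _ _ _ _ _ a b => a.cutFree ∧ b.cutFree
  | _, _, _, _, .impR _ _ _ _ _ _ a => a.cutFree
  | _, _, _, _, .box _ _ _ _ _ _ _ a bs => a.cutFree ∧ ∀ i, (bs i).cutFree
  | _, _, _, _, .cut _ _ _ _ _ _ => False

structure InfProof (c : Bool) (Γ Δ : Multiset Formula) : Type where
  frag : ∀ n : ℕ, Frag c n Γ Δ
  compat : ∀ n : ℕ, (frag (n+1)).trunc = frag n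

structure PP : Type where
  Γ : Multiset Formula
  Δ : Multiset Formula
  prf : InfProof true Γ Δ

def Sim : ℕ → PP → PP → Prop
  | 0, _, _ => True
  | n+1, π, τ => π.Γ = τ.Γ ∧ π.Δ = τ.Δ ∧ HEq (π.prf.frag (n+1)) (τ.prf.frag (n+1))

noncomputable def dP (π τ : PP) : ℝ :=
  sInf {r : ℝ | ∃ n : ℕ, Sim n π τ ∧ r = (1/2 : ℝ) ^ n}

def localHeight (π : PP) : ℕ := (π.prf.frag 1).height

def Pmem (n : ℕ) (π : PP) : Prop := (π.prf.frag n).cutFree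

namespace Frag

variable {c : Bool} {n : ℕ} {Γ Γ' Δ Δ' : Multiset Formula}

/-- Transport of a fragment along equalities of its two multisets. -/
def cast (hΓ : Γ = Γ') (hΔ : Δ = Δ') (f : Frag c n Γ Δ) : Frag c n Γ' Δ' :=
  hΓ ▸ hΔ ▸ f

theorem trunc_cast (hΓ : Γ = Γ') (hΔ : Δ = Δ') (f : Frag c (n + 1) Γ Δ) :
    (f.cast hΓ hΔ).trunc = f.trunc.cast hΓ hΔ := by
  subst hΓ hΔ
  rfl

theorem trunc_impL (A B : Formula) (f : Frag c (n + 2) (B ::ₘ Γ) Δ)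
    (g : Frag c (n + 2) Γ (A ::ₘ Δ)) :
    (impL c (n + 1) Γ Δ A B f g).trunc = impL c n Γ Δ A B f.trunc g.trunc := by
  rw [trunc]

theorem trunc_impR (A B : Formula) (f : Frag c (n + 2) (A ::ₘ Γ) (B ::ₘ Δ)) :
    (impR c (n + 1) Γ Δ A B f).trunc = impR c n Γ Δ A B f.trunc := by
  rw [trunc]

/-- The rule (□) with its conclusion and its left premise given up to equality. -/
def boxRule (Θ : Multiset Formula) (l : List Formula) (hl : l ≠ []) {Λ : Multiset Formula}
    (hΓ : Γ' + Θ.map Formula.box = Γ) (hΔ : (↑(l.map Formula.box) : Multiset Formula) + Δ' = Δ)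
    (hΛ : Λ = boxtimes ↑l) (left : Frag c (n + 1) (boxtimes Θ) Λ)
    (right : ∀ i : Fin l.length, Frag c n (boxtimes Θ) {l.get i}) : Frag c (n + 1) Γ Δ :=
  (Frag.box c n Γ' Δ' Θ l hl (left.cast rfl hΛ) right).cast hΓ hΔ

theorem trunc_boxRule (Θ : Multiset Formula) (l : List Formula) (hl : l ≠ [])
    {Λ : Multiset Formula} (hΓ : Γ' + Θ.map Formula.box = Γ)
    (hΔ : (↑(l.map Formula.box) : Multiset Formula) + Δ' = Δ)
    (hΛ : Λ = boxtimes ↑l) (left : Frag c (n + 2) (boxtimes Θ) Λ)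
    (right : ∀ i : Fin l.length, Frag c (n + 1) (boxtimes Θ) {l.get i}) :
    (boxRule Θ l hl hΓ hΔ hΛ left right).trunc =
      boxRule Θ l hl hΓ hΔ hΛ left.trunc fun i => (right i).trunc := by
  rw [boxRule, boxRule, trunc_cast, trunc, trunc_cast]

/-- The rule (□) with the single principal formula `□B` on the right. -/
def boxOne (Θ : Multiset Formula) (B : Formula)
    (hΓ : Γ' + Θ.map Formula.box = Γ) (hΔ : B.box ::ₘ Δ' = Δ)
    (left : Frag c (n + 1) (boxtimes Θ) {B, B.box})
    (right : Frag c n (boxtimes Θ) {B}) : Frag c (n + 1) Γ Δ :=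
  boxRule (Δ' := Δ') Θ [B] (List.cons_ne_nil _ _) hΓ
    (by rw [← hΔ]; exact Multiset.singleton_add _ _) (by exact rfl) left
    (fun | ⟨0, _⟩ => right)

theorem trunc_boxOne (Θ : Multiset Formula) (B : Formula)
    (hΓ : Γ' + Θ.map Formula.box = Γ) (hΔ : B.box ::ₘ Δ' = Δ)
    (left : Frag c (n + 2) (boxtimes Θ) {B, B.box})
    (right : Frag c (n + 1) (boxtimes Θ) {B}) :
    (boxOne Θ B hΓ hΔ left right).trunc = boxOne Θ B hΓ hΔ left.trunc right.trunc := by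
  refine (trunc_boxRule ..).trans (congrArg _ (funext fun i => ?_))
  match i with
  | ⟨0, _⟩ => rfl

/-- The rule (□) with the two principal formulas `□B` and `□C` on the right. -/
def boxTwo (Θ : Multiset Formula) (B C : Formula)
    (hΓ : Γ' + Θ.map Formula.box = Γ) (hΔ : B.box ::ₘ C.box ::ₘ Δ' = Δ)
    (left : Frag c (n + 1) (boxtimes Θ) {B, C, B.box, C.box})
    (right₁ : Frag c n (boxtimes Θ) {B}) (right₂ : Frag c n (boxtimes Θ) {C}) :
    Frag c (n + 1) Γ Δ :=
  boxRule (Δ' := Δ') Θ [B, C] (List.cons_ne_nil _ _) hΓ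
    (by rw [← hΔ, ← Multiset.singleton_add C.box, ← Multiset.cons_add]; rfl) (by exact rfl) left
    (fun | ⟨0, _⟩ => right₁ | ⟨1, _⟩ => right₂)

theorem trunc_boxTwo (Θ : Multiset Formula) (B C : Formula)
    (hΓ : Γ' + Θ.map Formula.box = Γ) (hΔ : B.box ::ₘ C.box ::ₘ Δ' = Δ)
    (left : Frag c (n + 2) (boxtimes Θ) {B, C, B.box, C.box})
    (right₁ : Frag c (n + 1) (boxtimes Θ) {B}) (right₂ : Frag c (n + 1) (boxtimes Θ) {C}) :
    (boxTwo Θ B C hΓ hΔ left right₁ right₂).trunc =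
      boxTwo Θ B C hΓ hΔ left.trunc right₁.trunc right₂.trunc := by
  refine (trunc_boxRule ..).trans (congrArg _ (funext fun i => ?_))
  match i with
  | ⟨0, _⟩ => rfl
  | ⟨1, _⟩ => rfl

/-- The fragments of the canonical proof of `B, Γ ⇒ B, Δ`. -/
def identity (c : Bool) : ∀ (B : Formula) (n : ℕ) (Γ Δ : Multiset Formula),
    Frag c n (B ::ₘ Γ) (B ::ₘ Δ)
  | _, 0, _, _ => .hole c _ _
  | .atom p, n + 1, Γ, Δ => .axP c n Γ Δ p
  | .bot, n + 1, Γ, _ => .axBot c n Γ _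
  | .imp B C, n + 1, Γ, Δ =>
      .impR c n _ Δ B C <|
        (Frag.impL c n (B ::ₘ Γ) (C ::ₘ Δ) B C (identity c C (n + 1) (B ::ₘ Γ) Δ)
          (identity c B (n + 1) Γ (C ::ₘ Δ))).cast (Multiset.cons_swap _ _ _) rfl
  | .box B, n + 1, Γ, Δ =>
      boxOne (Γ' := Γ) (Δ' := Δ) {B} B
        (by rw [Multiset.map_singleton, Multiset.add_comm, Multiset.singleton_add]) rfl
        (identity c B (n + 1) {B.box} {B.box}) (identity c B n {B.box} 0)

theorem trunc_identity (B : Formula) (n : ℕ) (Γ Δ : Multiset Formula) :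
    (identity c B (n + 1) Γ Δ).trunc = identity c B n Γ Δ := by
  induction B generalizing n Γ Δ with
  | atom p => cases n <;> simp only [identity, trunc]
  | bot => cases n <;> simp only [identity, trunc]
  | imp B C ihB ihC => cases n <;> simp only [identity, trunc, trunc_cast, ihB, ihC]
  | box B ih =>
    cases n with
    | zero => simp only [identity, trunc]
    | succ n =>
      rw [identity, identity]
      exact (trunc_boxOne ..).trans (congrArg₂ _ (ih ..) (ih ..))

end Frag

namespace Formula

/-- The formula `A → □A`. -/
def step (A : Formula) : Formula := A.imp A.box

/-- The formula `□(A → □A) → A`. -/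
def grz (A : Formula) : Formula := A.step.box.imp A

end Formula

namespace Frag

variable {c : Bool} {n : ℕ} {Γ Δ : Multiset Formula}

/-- `⊠(□(A → □A) → A) ⇒ A, A → □A, □A, □(A → □A)`. -/
def stepLeft (c : Bool) (n : ℕ) (A : Formula) :
    Frag c (n + 1) (boxtimes {A.grz}) {A, A.step, A.box, A.step.box} :=
  (Frag.impR c n (boxtimes {A.grz}) {A, A.box, A.step.box} A A.box
    ((identity c A (n + 1) (boxtimes {A.grz}) {A.box, A.box, A.step.box}).cast rfl
      (Multiset.cons_swap _ _ _))).cast rfl (Multiset.cons_swap _ _ _)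

/-- `Γ, □(□(A → □A) → A) ⇒ □A, □(A → □A), Δ`. -/
def boxBoth (A : Formula) (Γ Δ : Multiset Formula)
    (p : Frag c n (boxtimes {A.grz}) {A}) (q : Frag c n (boxtimes {A.grz}) {A.step}) :
    Frag c (n + 1) (Γ + {A.grz.box}) (A.box ::ₘ A.step.box ::ₘ Δ) :=
  boxTwo {A.grz} A A.step rfl rfl (stepLeft c n A) p q

/-- `⊠(□(A → □A) → A) ⇒ A, Δ`, from `□(□(A → □A) → A) ⇒ □(A → □A), A, Δ`. -/
def unfoldGrz (A : Formula) (Δ : Multiset Formula)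
    (f : Frag c (n + 1) {A.grz.box} (A.step.box ::ₘ A ::ₘ Δ)) :
    Frag c (n + 1) (boxtimes {A.grz}) (A ::ₘ Δ) :=
  Frag.impL c n {A.grz.box} (A ::ₘ Δ) A.step.box A
    (identity c A (n + 1) {A.grz.box} Δ) f

/-- `⊠(□(A → □A) → A) ⇒ A, □A`. -/
def boxedLeft (A : Formula)
    (p : Frag c n (boxtimes {A.grz}) {A}) (q : Frag c n (boxtimes {A.grz}) {A.step}) :
    Frag c (n + 1) (boxtimes {A.grz}) {A, A.box} :=
  unfoldGrz A {A.box} <| (boxBoth A 0 {A} p q).cast (zero_add _) <| by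
    rw [Multiset.cons_swap]
    exact congrArg _ (Multiset.cons_swap _ _ _)

/-- `Γ, □(□(A → □A) → A) ⇒ □A`. -/
def boxed (A : Formula) (Γ : Multiset Formula)
    (p : Frag c n (boxtimes {A.grz}) {A}) (q : Frag c n (boxtimes {A.grz}) {A.step}) :
    Frag c (n + 1) (Γ + {A.grz.box}) {A.box} :=
  boxOne {A.grz} A (Γ' := Γ) (Δ' := 0) rfl rfl (boxedLeft A p q) p

/-- One unfolding of the cyclic proof of `⊠(□(A → □A) → A) ⇒ A`. -/
def nextSelf (A : Formula)
    (p : Frag c n (boxtimes {A.grz}) {A}) (q : Frag c n (boxtimes {A.grz}) {A.step}) :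
    Frag c (n + 1) (boxtimes {A.grz}) {A} :=
  unfoldGrz A 0 <| boxOne {A.grz} A.step (Γ' := 0) (Δ' := {A}) (zero_add _) rfl
    (.impR c n (boxtimes {A.grz}) {A.step.box} A A.box
      (boxBoth A (A ::ₘ {A.grz}) 0 p q)) q

/-- One unfolding of the cyclic proof of `⊠(□(A → □A) → A) ⇒ A → □A`. -/
def nextStep (A : Formula)
    (p : Frag c n (boxtimes {A.grz}) {A}) (q : Frag c n (boxtimes {A.grz}) {A.step}) :
    Frag c (n + 1) (boxtimes {A.grz}) {A.step} :=
  .impR c n (boxtimes {A.grz}) 0 A A.box (boxed A (A ::ₘ {A.grz}) p q)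

section

variable (A : Formula) (p : Frag c (n + 1) (boxtimes {A.grz}) {A})
  (q : Frag c (n + 1) (boxtimes {A.grz}) {A.step})

theorem trunc_stepLeft : (stepLeft c (n + 1) A).trunc = stepLeft c n A :=
  (trunc_cast ..).trans <| congrArg _ <| (trunc_impR ..).trans <| congrArg _ <|
    (trunc_cast ..).trans <| congrArg _ (trunc_identity ..)

theorem trunc_boxBoth :
    (boxBoth A Γ Δ p q).trunc = boxBoth A Γ Δ p.trunc q.trunc :=
  (trunc_boxTwo ..).trans <|
    congrArg (fun f => boxTwo {A.grz} A A.step rfl rfl f p.trunc q.trunc) (trunc_stepLeft A)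

theorem trunc_unfoldGrz (f : Frag c (n + 2) {A.grz.box} (A.step.box ::ₘ A ::ₘ Δ)) :
    (unfoldGrz A Δ f).trunc = unfoldGrz A Δ f.trunc :=
  (trunc_impL ..).trans (congrArg (fun g => impL c n _ _ _ _ g f.trunc) (trunc_identity ..))

theorem trunc_boxedLeft : (boxedLeft A p q).trunc = boxedLeft A p.trunc q.trunc :=
  (trunc_unfoldGrz ..).trans <| congrArg _ <| (trunc_cast ..).trans <|
    congrArg _ (trunc_boxBoth A p q)

theorem trunc_boxed : (boxed A Γ p q).trunc = boxed A Γ p.trunc q.trunc :=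
  (trunc_boxOne ..).trans <|
    congrArg (fun f => boxOne {A.grz} A rfl rfl f p.trunc) (trunc_boxedLeft A p q)

theorem trunc_nextSelf : (nextSelf A p q).trunc = nextSelf A p.trunc q.trunc :=
  (trunc_unfoldGrz ..).trans <| congrArg _ <| (trunc_boxOne ..).trans <|
    congrArg (fun f => boxOne {A.grz} A.step (zero_add _) rfl f q.trunc) <|
      (trunc_impR ..).trans <| congrArg _ (trunc_boxBoth A p q)

theorem trunc_nextStep : (nextStep A p q).trunc = nextStep A p.trunc q.trunc :=
  (trunc_impR ..).trans <| congrArg _ (trunc_boxed A p q)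

end

/-- The fragments of the cyclic proofs of `⊠(□(A → □A) → A) ⇒ A` and
`⊠(□(A → □A) → A) ⇒ A → □A`. -/
def cyclic (c : Bool) (A : Formula) :
    ∀ n, Frag c n (boxtimes {A.grz}) {A} × Frag c n (boxtimes {A.grz}) {A.step}
  | 0 => (.hole c _ _, .hole c _ _)
  | n + 1 => (nextSelf A (cyclic c A n).1 (cyclic c A n).2,
      nextStep A (cyclic c A n).1 (cyclic c A n).2)

theorem trunc_cyclic (A : Formula) (n : ℕ) :
    (cyclic c A (n + 1)).1.trunc = (cyclic c A n).1 ∧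
      (cyclic c A (n + 1)).2.trunc = (cyclic c A n).2 := by
  induction n with
  | zero => exact ⟨by simp only [trunc, cyclic], by simp only [trunc, cyclic]⟩
  | succ n ih =>
    constructor
    · rw [cyclic, trunc_nextSelf, ih.1, ih.2, cyclic]
    · rw [cyclic, trunc_nextStep, ih.1, ih.2, cyclic]

/-- The fragments of a proof of `□(□(A → □A) → A) ⇒ □A`. -/
def grzProof (c : Bool) (A : Formula) : ∀ n, Frag c n {A.grz.box} {A.box}
  | 0 => .hole c _ _
  | n + 1 => (boxed A 0 (cyclic c A n).1 (cyclic c A n).2).cast (zero_add _) rfl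

theorem trunc_grzProof (A : Formula) (n : ℕ) :
    (grzProof c A (n + 1)).trunc = grzProof c A n := by
  cases n with
  | zero => simp only [trunc, grzProof]
  | succ n =>
    rw [grzProof, trunc_cast, trunc_boxed, (trunc_cyclic A n).1, (trunc_cyclic A n).2, grzProof]

end Frag

theorem stmt3 (A : Formula) :
    Nonempty (InfProof false
      {Formula.box ((Formula.box (A.imp (Formula.box A))).imp A)}
      {Formula.box A}) := by
  exact ⟨⟨Frag.grzProof false A, Frag.trunc_grzProof A⟩⟩
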